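/- Let m ≥ 4 and let e be an integer with 1 ≤ e ≤ m/2 such that m/gcd(m,e) is odd, and set h = (m − gcd(m,e))/2. Then the supports of the codewords of C̄_e^⊥ of a fixed weight k form the blocks of a 2-(2^m, k, λ) design on the point set F for each of the following pairs: (i) k = 2^{m−1}−2^{m−1−h} with λ = (2^{2h−1}−2^{h−1})(2^{m−1}−2^{m−1−h}−1); (ii) k = 2^{m−1}+2^{m−1−h} with λ = (2^{2h−1}+2^{h−1})(2^{m−1}+2^{m−1−h}−1); (iii) k = 2^{m−1} with λ = (2^{m−1}−1)(2^m−2^{2h}+1). That is, for each such (k,λ), every 2-element subset of F is contained in the supports of exactly λ codewords of C̄_e^⊥ of weight k. -/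

import Mathlib

noncomputable local instance (m : ℕ) : Fintype (GaloisField 2 m) := Fintype.ofFinite _
attribute [local instance] Classical.propDecidable

/-- `∑_{g∈F} ι(c(g))·g^s ∈ F = GF(2^m)`, where `ι : 𝔽₂ → F` is the unique ring hom. -/
noncomputable def phiF (m s : ℕ) :
    (GaloisField 2 m → ZMod 2) →ₗ[ZMod 2] GaloisField 2 m where
  toFun c := ∑ g, algebraMap (ZMod 2) (GaloisField 2 m) (c g) * g ^ s
  map_add' c d := by simp [add_mul, Finset.sum_add_distrib]
  map_smul' a c := by simp [Algebra.smul_def, mul_assoc, Finset.mul_sum]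

/-- The parity functional `c ↦ ∑_{g∈F} c(g) ∈ 𝔽₂`. -/
noncomputable def parF (m : ℕ) : (GaloisField 2 m → ZMod 2) →ₗ[ZMod 2] ZMod 2 where
  toFun c := ∑ g, c g
  map_add' c d := by simp [Finset.sum_add_distrib]
  map_smul' a c := by simp [Finset.mul_sum]

/-- The extended binary cyclic code `C̄_e` of length `2^m`, with coordinates indexed by
`F = GF(2^m)`: all `c : F → 𝔽₂` with `∑_{g∈F} c(g) = 0` in `𝔽₂`,
`∑_{g∈F} ι(c(g))·g = 0` and `∑_{g∈F} ι(c(g))·g^{2^e+1} = 0` in `F`. -/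
noncomputable def extCode (m e : ℕ) : Submodule (ZMod 2) (GaloisField 2 m → ZMod 2) :=
  LinearMap.ker (parF m) ⊓ LinearMap.ker (phiF m 1) ⊓ LinearMap.ker (phiF m (2 ^ e + 1))

/-- The dual code `C̄_e^⊥`. -/
noncomputable def dualCode (m e : ℕ) : Submodule (ZMod 2) (GaloisField 2 m → ZMod 2) where
  carrier := {y | ∀ c ∈ extCode m e, ∑ g, c g * y g = 0}
  add_mem' := by
    intro a b ha hb c hc
    simp only [Pi.add_apply, mul_add, Finset.sum_add_distrib, ha c hc, hb c hc, add_zero]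
  zero_mem' := by intro c hc; simp
  smul_mem' := by
    intro a y hy c hc
    simp only [Pi.smul_apply, smul_eq_mul, mul_left_comm, ← Finset.mul_sum, hy c hc, mul_zero]

/-- The Hamming weight of a codeword. -/
noncomputable def wt {m : ℕ} (y : GaloisField 2 m → ZMod 2) : ℕ :=
  (Finset.univ.filter fun g => y g ≠ 0).card


open Finset

/-- The nontrivial additive character of `𝔽₂`, with values in `ℤ`. -/
noncomputable def sgn (t : ZMod 2) : ℤ := if t = 0 then 1 else -1

lemma zmod_two_eq_one {t : ZMod 2} (ht : t ≠ 0) : t = 1 := by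
  fin_cases t
  · exact absurd rfl ht
  · rfl

@[simp] lemma sgn_zero : sgn 0 = 1 := if_pos rfl

@[simp] lemma sgn_one : sgn 1 = -1 := if_neg one_ne_zero

lemma sgn_add (s t : ZMod 2) : sgn (s + t) = sgn s * sgn t := by
  have h2 : (1 : ZMod 2) + 1 = 0 := CharTwo.add_self_eq_zero 1
  by_cases hs : s = 0
  · simp [hs]
  · by_cases ht : t = 0
    · simp [ht]
    · simp [zmod_two_eq_one hs, zmod_two_eq_one ht, h2]

lemma sgn_mul_self (t : ZMod 2) : sgn t * sgn t = 1 := by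
  rw [← sgn_add, CharTwo.add_self_eq_zero, sgn_zero]

lemma sum_sgn_eq {α : Type*} [Fintype α] (y : α → ZMod 2) :
    ∑ g, sgn (y g) = Fintype.card α - 2 * ((univ.filter fun g => y g ≠ 0).card : ℤ) := by
  have key : ∀ t : ZMod 2, sgn t = 1 - 2 * (if t ≠ 0 then 1 else 0) := by
    intro t
    by_cases ht : t = 0
    · simp [ht]
    · simp [zmod_two_eq_one ht]
  simp_rw [key, sum_sub_distrib, ← mul_sum, sum_boole]
  simp

/-- The sum of a nontrivial character over a finite group vanishes. -/
lemma sum_sgn_eq_zero {A : Type*} [AddGroup A] [Fintype A] (f : A → ZMod 2)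
    (hf : ∀ u v, f (u + v) = f u + f v) {u₀ : A} (hu : f u₀ ≠ 0) : ∑ u, sgn (f u) = 0 := by
  have h : ∑ u, sgn (f (u + u₀)) = ∑ u, sgn (f u) :=
    Fintype.sum_equiv (Equiv.addRight u₀) _ _ fun _ => rfl
  simp_rw [hf, zmod_two_eq_one hu, sgn_add, sgn_one, mul_neg, mul_one, sum_neg_distrib] at h
  linarith

section Walsh

variable {F : Type*} [Field F] [Fintype F] [Algebra (ZMod 2) F]

lemma charP_two_of_algebra (F : Type*) [Field F] [Algebra (ZMod 2) F] : CharP F 2 :=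
  charP_of_injective_algebraMap (algebraMap (ZMod 2) F).injective 2

/-- The absolute trace of `F`. -/
noncomputable abbrev absTr (x : F) : ZMod 2 := Algebra.trace (ZMod 2) F x

lemma exists_absTr_mul_ne_zero {a : F} (ha : a ≠ 0) : ∃ b : F, absTr (a * b) ≠ 0 := by
  by_contra! hb
  exact ha ((traceForm_nondegenerate (ZMod 2) F).1 a fun b => hb b)

lemma absTr_pow_two_pow (x : F) (e : ℕ) : absTr (x ^ 2 ^ e) = absTr x := by
  induction e with
  | zero => simp
  | succ e ih =>
    rw [pow_succ, pow_mul, ← ih]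
    have := Algebra.trace_eq_of_algEquiv
      (FiniteField.frobeniusAlgEquivOfAlgebraic (ZMod 2) F) (x ^ 2 ^ e)
    rwa [FiniteField.coe_frobeniusAlgEquivOfAlgebraic, ZMod.card] at this

lemma sum_sgn_absTr_mul (c : F) :
    ∑ g, sgn (absTr (c * g)) = if c = 0 then (Fintype.card F : ℤ) else 0 := by
  split_ifs with hc
  · simp [hc]
  · obtain ⟨b, hb⟩ := exists_absTr_mul_ne_zero hc
    exact sum_sgn_eq_zero (fun g => absTr (c * g)) (fun u v => by simp [mul_add]) hb

/-- The quadratic function `g ↦ Tr (a g ^ (2 ^ e + 1) + b g)`. -/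
noncomputable def quadFun (e : ℕ) (a b g : F) : ZMod 2 := absTr (a * g ^ (2 ^ e + 1) + b * g)

/-- The Walsh transform of `g ↦ Tr (a g ^ (2 ^ e + 1))` at `b`. -/
noncomputable def walsh (e : ℕ) (a b : F) : ℤ := ∑ g, sgn (quadFun e a b g)

/-- The linearized polynomial whose kernel is the radical of the quadratic form
`g ↦ Tr (a g ^ (2 ^ e + 1))`. -/
def radMap (e : ℕ) (a u : F) : F := a ^ 2 ^ e * u ^ 2 ^ (2 * e) + a * u

omit [Fintype F] in
lemma radMap_add (e : ℕ) (a u v : F) : radMap e a (u + v) = radMap e a u + radMap e a v := by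
  have := charP_two_of_algebra F
  simp only [radMap, add_pow_char_pow]
  ring

lemma quadFun_add (e : ℕ) (a b u g : F) :
    quadFun e a b (u + g) =
      quadFun e a b u + quadFun e a b g + absTr (radMap e a u * g ^ 2 ^ e) := by
  have := charP_two_of_algebra F
  have h1 : absTr (radMap e a u * g ^ 2 ^ e) =
      absTr (a * u ^ 2 ^ e * g) + absTr (a * u * g ^ 2 ^ e) := by
    rw [← absTr_pow_two_pow (a * u ^ 2 ^ e * g) e, radMap, absTr, ← map_add]
    congr 1
    rw [mul_pow, mul_pow, ← pow_mul, ← pow_add, two_mul]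
    ring
  rw [h1]
  simp only [quadFun, absTr, ← map_add]
  congr 1
  rw [pow_succ, add_pow_char_pow]
  ring

lemma sum_sgn_absTr_mul_pow (e : ℕ) (c : F) :
    ∑ g : F, sgn (absTr (c * g ^ 2 ^ e)) = if c = 0 then (Fintype.card F : ℤ) else 0 := by
  have := charP_two_of_algebra F
  rw [← sum_sgn_absTr_mul c]
  have hbij : Function.Bijective (iterateFrobenius F 2 e) :=
    Finite.injective_iff_bijective.1 (iterateFrobenius F 2 e).injective
  exact Fintype.sum_bijective _ hbij _ _ fun g => by rw [iterateFrobenius_def]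

lemma walsh_sq (e : ℕ) (a b : F) :
    walsh e a b ^ 2 =
      Fintype.card F * ∑ u ∈ univ.filter (fun u => radMap e a u = 0), sgn (quadFun e a b u) := by
  have h1 : ∀ g : F, ∑ g' : F, sgn (quadFun e a b g) * sgn (quadFun e a b g') =
      ∑ u : F, sgn (quadFun e a b u) * sgn (absTr (radMap e a u * g ^ 2 ^ e)) := by
    intro g
    refine (Fintype.sum_equiv (Equiv.addRight g) _ _ fun u => ?_).symm
    rw [Equiv.coe_addRight, quadFun_add, sgn_add, sgn_add]
    linear_combination -sgn (quadFun e a b u) * sgn (absTr (radMap e a u * g ^ 2 ^ e)) *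
      sgn_mul_self (quadFun e a b g)
  rw [walsh, sq, sum_mul_sum]
  simp_rw [h1]
  rw [sum_comm]
  simp_rw [← mul_sum, sum_sgn_absTr_mul_pow, mul_ite, mul_zero]
  rw [← sum_filter, mul_sum]
  exact sum_congr rfl fun _ _ => mul_comm _ _

/-- The squared Walsh transform is either zero or `#F` times the size of the radical. -/
lemma walsh_sq_eq_or (e : ℕ) (a b : F) :
    walsh e a b ^ 2 = 0 ∨
      walsh e a b ^ 2 = Fintype.card F * (univ.filter fun u => radMap e a u = 0).card := by
  let R : AddSubgroup F := (AddMonoidHom.mk' (radMap e a) (radMap_add e a)).ker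
  have hR : ∑ u ∈ univ.filter (fun u => radMap e a u = 0), sgn (quadFun e a b u) =
      ∑ u : R, sgn (quadFun e a b u) :=
    sum_subtype _ (fun u => by simp [R, AddMonoidHom.mem_ker]) _
  have hc : (univ.filter fun u => radMap e a u = 0).card = Fintype.card R :=
    (Fintype.card_of_subtype _ fun u => by simp [R, AddMonoidHom.mem_ker]).symm
  rw [walsh_sq, hR, hc]
  by_cases hu : ∃ u₀ : R, quadFun e a b u₀ ≠ 0
  · obtain ⟨u₀, hu₀⟩ := hu
    left
    rw [sum_sgn_eq_zero (fun u : R => quadFun e a b u) _ hu₀, mul_zero]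
    intro u v
    have : radMap e a u = 0 := u.2
    simp [quadFun_add, this]
  · push Not at hu
    right
    simp [hu]

lemma sum_walsh_sq (e : ℕ) (a : F) : ∑ b, walsh e a b ^ 2 = (Fintype.card F : ℤ) ^ 2 := by
  have := charP_two_of_algebra F
  have h1 : ∀ b : F, walsh e a b ^ 2 = ∑ g, ∑ g',
      sgn (quadFun e a 0 g) * sgn (quadFun e a 0 g') * sgn (absTr ((g + g') * b)) := by
    intro b
    rw [walsh, sq, sum_mul_sum]
    refine sum_congr rfl fun g _ => sum_congr rfl fun g' _ => ?_
    simp only [← sgn_add, quadFun, absTr, ← map_add]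
    congr 2
    ring
  simp_rw [h1]
  rw [sum_comm]
  have h2 : ∀ g : F, ∑ b : F, ∑ g' : F,
      sgn (quadFun e a 0 g) * sgn (quadFun e a 0 g') * sgn (absTr ((g + g') * b)) =
      Fintype.card F := by
    intro g
    rw [sum_comm]
    simp_rw [← mul_sum, sum_sgn_absTr_mul, CharTwo.add_eq_zero, mul_ite, mul_zero]
    rw [sum_ite_eq univ g]
    simp [sgn_mul_self]
  simp_rw [h2]
  simp [sq]

end Walsh

section Arithmetic

lemma gcd_two_mul_eq {m e : ℕ} (hm : 0 < m) (hodd : Odd (m / m.gcd e)) :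
    (2 * e).gcd m = m.gcd e := by
  have hd : 0 < m.gcd e := Nat.gcd_pos_of_pos_left e hm
  obtain ⟨k, j, hkj, hk, hj⟩ := Nat.exists_coprime m e
  generalize m.gcd e = d at *
  subst hk hj
  rw [Nat.mul_div_cancel _ hd] at hodd
  rw [← mul_assoc, Nat.gcd_mul_right]
  have h2 : Nat.Coprime (2 * j) k :=
    Nat.Coprime.mul_left (Nat.coprime_two_left.2 hodd) hkj.symm
  rw [h2.gcd_eq_one, one_mul]

lemma coprime_two_pow_sub_one_two_pow_add_one {m e : ℕ} (h : (2 * e).gcd m = m.gcd e)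
    (he : 1 ≤ e) : Nat.Coprime (2 ^ m - 1) (2 ^ e + 1) := by
  have h1 : 2 ^ (2 * e) - 1 = (2 ^ e + 1) * (2 ^ e - 1) := by
    rw [mul_comm 2 e, pow_mul]
    simpa using Nat.sq_sub_sq (2 ^ e) 1
  have hg : (2 ^ m - 1).gcd (2 ^ e + 1) ∣ 2 ^ e - 1 := by
    have h2 : (2 ^ m - 1).gcd (2 ^ e + 1) ∣ (2 ^ (2 * e) - 1).gcd (2 ^ m - 1) :=
      Nat.dvd_gcd (h1 ▸ (Nat.gcd_dvd_right _ _).mul_right _) (Nat.gcd_dvd_left _ _)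
    rw [Nat.pow_sub_one_gcd_pow_sub_one, h, ← Nat.pow_sub_one_gcd_pow_sub_one] at h2
    exact h2.trans (Nat.gcd_dvd_right _ _)
  have h3 : (2 ^ m - 1).gcd (2 ^ e + 1) ∣ 2 := by
    have h4 := Nat.dvd_sub (Nat.gcd_dvd_right (2 ^ m - 1) (2 ^ e + 1)) hg
    have : 0 < 2 ^ e := by positivity
    rwa [show 2 ^ e + 1 - (2 ^ e - 1) = 2 by omega] at h4
  have h5 : ¬ 2 ∣ 2 ^ e + 1 := by
    have : 2 ∣ 2 ^ e := dvd_pow_self 2 (by omega)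
    omega
  rcases (Nat.dvd_prime Nat.prime_two).1 h3 with h6 | h6
  · exact h6
  · exact absurd (h6.symm.dvd.trans (Nat.gcd_dvd_right (2 ^ m - 1) (2 ^ e + 1))) h5

lemma exists_eq_gcd_add_two_mul {m e : ℕ} (he1 : 1 ≤ e) (he2 : 2 * e ≤ m)
    (hodd : Odd (m / m.gcd e)) :
    1 ≤ (m - m.gcd e) / 2 ∧ m = m.gcd e + 2 * ((m - m.gcd e) / 2) := by
  have hd : 0 < m.gcd e := Nat.gcd_pos_of_pos_right m (by omega)
  have hde : m.gcd e ≤ e := Nat.gcd_le_right m (by omega)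
  obtain ⟨r, hr⟩ := hodd
  have hm : m = m.gcd e * (2 * r + 1) := by
    rw [← hr, Nat.mul_div_cancel' (Nat.gcd_dvd_left m e)]
  generalize m.gcd e = d at *
  have h1 : m - d = 2 * (d * r) := by
    rw [hm, mul_add, mul_one, Nat.add_sub_cancel]
    ring
  omega

end Arithmetic

section Radical

variable {F : Type*} [Field F] [Fintype F] [Algebra (ZMod 2) F]

omit [Fintype F] in
lemma radMap_eq_zero_iff (e : ℕ) {a u : F} (ha : a ≠ 0) (hu : u ≠ 0) :
    radMap e a u = 0 ↔ (u ^ (2 ^ e + 1) * a) ^ (2 ^ e - 1) = 1 := by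
  have := charP_two_of_algebra F
  have hv : u ^ (2 ^ e + 1) * a ≠ 0 := mul_ne_zero (pow_ne_zero _ hu) ha
  have h0 : 2 ^ e - 1 + 1 = 2 ^ e := Nat.sub_add_cancel Nat.one_le_two_pow
  rw [← mul_left_inj' (a := (u ^ (2 ^ e + 1) * a) ^ (2 ^ e - 1)) hv, one_mul, ← pow_succ, h0,
    radMap, CharTwo.add_eq_zero, ← mul_right_inj' (pow_ne_zero (2 ^ e) hu)]
  have h1 : u ^ 2 ^ e * (a ^ 2 ^ e * u ^ 2 ^ (2 * e)) = (u ^ (2 ^ e + 1) * a) ^ 2 ^ e := by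
    rw [mul_pow, ← pow_mul, two_mul, pow_add 2 e e]
    ring
  have h2 : u ^ 2 ^ e * (a * u) = u ^ (2 ^ e + 1) * a := by ring
  rw [h1, h2]

lemma card_radMap_eq_zero {m e : ℕ} (hF : Fintype.card F = 2 ^ m) (he : 1 ≤ e)
    (h : (2 * e).gcd m = m.gcd e) {a : F} (ha : a ≠ 0) :
    (univ.filter fun u => radMap e a u = 0).card = 2 ^ m.gcd e := by
  have hcard : Nat.card Fˣ = 2 ^ m - 1 := by
    rw [Nat.card_units, Nat.card_eq_fintype_card, hF]
  have hcop : (Nat.card Fˣ).Coprime (2 ^ e + 1) := by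
    rw [hcard]
    exact coprime_two_pow_sub_one_two_pow_add_one h he
  have hker : Nat.card (powMonoidHom (2 ^ e - 1) : Fˣ →* Fˣ).ker = 2 ^ m.gcd e - 1 := by
    rw [IsCyclic.card_powMonoidHom_ker, hcard, Nat.pow_sub_one_gcd_pow_sub_one]
  have hequiv : {u : Fˣ // radMap e a u = 0} ≃ (powMonoidHom (2 ^ e - 1) : Fˣ →* Fˣ).ker :=
    ((powCoprime hcop).trans (Equiv.mulRight (Units.mk0 a ha))).subtypeEquiv fun u => by
      rw [radMap_eq_zero_iff e ha u.ne_zero, MonoidHom.mem_ker, ← Units.val_inj]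
      simp
  have hset : (univ.filter fun u => radMap e a u = 0) =
      insert 0 ((univ.filter fun u : Fˣ => radMap e a u = 0).map
        ⟨Units.val, Units.val_injective⟩) := by
    ext u
    rcases eq_or_ne u 0 with rfl | hu
    · simp only [mem_filter, mem_univ, true_and, mem_insert, true_or, iff_true]
      simp [radMap]
    · suffices radMap e a u = 0 ↔ ∃ v : Fˣ, radMap e a v = 0 ∧ (v : F) = u by simpa [hu]
      exact ⟨fun hr => ⟨Units.mk0 u hu, hr, rfl⟩, fun ⟨v, hv, hvu⟩ => hvu ▸ hv⟩
  rw [hset, card_insert_of_notMem (by simp), card_map, ← Fintype.card_subtype,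
    ← Nat.card_eq_fintype_card, Nat.card_congr hequiv, hker]
  exact Nat.sub_add_cancel Nat.one_le_two_pow

end Radical

section Counting

variable {F : Type*} [Field F] [Fintype F] [Algebra (ZMod 2) F]

/-- The codeword `g ↦ Tr (a g ^ (2 ^ e + 1) + b g) + c` attached to `(a, b, c)`. -/
noncomputable def codeMap (F : Type*) [Field F] [Algebra (ZMod 2) F] (e : ℕ) :
    (F × F × ZMod 2) →ₗ[ZMod 2] (F → ZMod 2) where
  toFun p g := quadFun e p.1 p.2.1 g + p.2.2
  map_add' p q := by
    funext g
    simp only [quadFun, absTr, Prod.fst_add, Prod.snd_add, Pi.add_apply, add_mul, map_add]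
    ring
  map_smul' t p := by
    funext g
    simp only [quadFun, absTr, Prod.smul_fst, Prod.smul_snd, Pi.smul_apply, smul_mul_assoc,
      ← smul_add, map_smul, RingHom.id_apply]

omit [Fintype F] in
lemma codeMap_apply (e : ℕ) (p : F × F × ZMod 2) (g : F) :
    codeMap F e p g = quadFun e p.1 p.2.1 g + p.2.2 := rfl

lemma sgn_mul_walsh (e : ℕ) (p : F × F × ZMod 2) :
    sgn p.2.2 * walsh e p.1 p.2.1 =
      Fintype.card F - 2 * ((univ.filter fun g => codeMap F e p g ≠ 0).card : ℤ) := by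
  simp_rw [← sum_sgn_eq, codeMap_apply, sgn_add, ← sum_mul, walsh, mul_comm]

lemma walsh_zero_left (e : ℕ) (b : F) :
    walsh e 0 b = if b = 0 then (Fintype.card F : ℤ) else 0 := by
  rw [← sum_sgn_absTr_mul]
  simp [walsh, quadFun]

lemma codeMap_injective {e : ℕ}
    (hne : ∀ a : F, a ≠ 0 → ∀ b, walsh e a b ^ 2 ≠ (Fintype.card F : ℤ) ^ 2) :
    Function.Injective (codeMap F e) := by
  rw [injective_iff_map_eq_zero]
  intro p hp
  obtain ⟨a, b, c⟩ := p
  have h1 := sgn_mul_walsh e (a, b, c)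
  rw [hp] at h1
  simp only [Pi.zero_apply, ne_eq, not_true_eq_false, filter_false, card_empty, Nat.cast_zero,
    mul_zero, sub_zero] at h1
  have ha : a = 0 := by
    by_contra ha
    apply hne a ha b
    rw [← h1]
    linear_combination -walsh e a b ^ 2 * sgn_mul_self c
  subst ha
  have hb : b = 0 := by
    by_contra hb
    rw [walsh_zero_left, if_neg hb, mul_zero] at h1
    exact Fintype.card_ne_zero (α := F) (by exact_mod_cast h1.symm)
  subst hb
  have hc := congrFun hp 0
  simp only [codeMap_apply, quadFun, absTr, zero_mul, add_zero, map_zero, zero_add,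
    Pi.zero_apply] at hc
  rw [hc]
  rfl

lemma sum_zmod_two {M : Type*} [AddCommMonoid M] (f : ZMod 2 → M) : ∑ c, f c = f 0 + f 1 :=
  Fin.sum_univ_two f

lemma card_sgn_mul_walsh_eq (e : ℕ) (t : ℤ) :
    (univ.filter fun p : F × F × ZMod 2 => sgn p.2.2 * walsh e p.1 p.2.1 = t).card =
      ∑ a : F, ∑ b : F,
        ((if walsh e a b = t then 1 else 0) + (if -walsh e a b = t then 1 else 0)) := by
  simp_rw [card_filter, Fintype.sum_prod_type, sum_zmod_two, sgn_zero, sgn_one, one_mul,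
    neg_one_mul]

variable {e : ℕ} {T : ℤ} {N : ℕ}

lemma card_walsh_ne_zero (hT : T ≠ 0)
    (hN : (N : ℤ) * T ^ 2 = (Fintype.card F : ℤ) ^ 2) {a : F}
    (hw : ∀ b, walsh e a b ^ 2 = 0 ∨ walsh e a b ^ 2 = T ^ 2) :
    (univ.filter fun b => walsh e a b ≠ 0).card = N := by
  have h1 : ∀ b, walsh e a b ^ 2 = if walsh e a b ≠ 0 then T ^ 2 else 0 := by
    intro b
    split_ifs with hb
    · exact (hw b).resolve_left (pow_ne_zero 2 hb)
    · rw [not_not.1 hb, zero_pow two_ne_zero]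
  have h2 := sum_walsh_sq e a
  rw [sum_congr rfl fun b _ => h1 b, ← sum_filter, sum_const, nsmul_eq_mul, ← hN] at h2
  exact_mod_cast mul_right_cancel₀ (pow_ne_zero 2 hT) h2

lemma card_sgn_mul_walsh_eq_of_ne_zero (hT : T ≠ 0)
    (hN : (N : ℤ) * T ^ 2 = (Fintype.card F : ℤ) ^ 2)
    (hTF : T ^ 2 ≠ (Fintype.card F : ℤ) ^ 2)
    (hw : ∀ a : F, a ≠ 0 → ∀ b, walsh e a b ^ 2 = 0 ∨ walsh e a b ^ 2 = T ^ 2) :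
    (univ.filter fun p : F × F × ZMod 2 => sgn p.2.2 * walsh e p.1 p.2.1 = T).card =
      (Fintype.card F - 1) * N := by
  have key : ∀ a : F, ∑ b : F,
      ((if walsh e a b = T then 1 else 0) + (if -walsh e a b = T then 1 else 0)) =
        if a ≠ 0 then N else 0 := by
    intro a
    split_ifs with ha
    · rw [← card_walsh_ne_zero hT hN (hw a ha), card_filter]
      refine sum_congr rfl fun b _ => ?_
      rcases hw a ha b with h | h
      · simp [pow_eq_zero_iff two_ne_zero |>.1 h, hT.symm]
      · rcases sq_eq_sq_iff_eq_or_eq_neg.1 h with h | h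
        · have : ¬ -T = T := by omega
          simp [h, hT, this]
        · have : ¬ -T = T := by omega
          simp [h, hT, this]
    · rw [not_not] at ha
      subst ha
      refine sum_eq_zero fun b _ => ?_
      rw [walsh_zero_left]
      by_cases hb : b = 0
      · have h1 : ¬ (Fintype.card F : ℤ) = T := fun h => hTF (by rw [h])
        have h2 : ¬ -(Fintype.card F : ℤ) = T := fun h => hTF (by rw [← h, neg_sq])
        simp [hb, h1, h2]
      · simp [hb, hT.symm]
  rw [card_sgn_mul_walsh_eq, sum_congr rfl fun a _ => key a, ← sum_filter, sum_const,
    filter_ne' univ (0 : F), card_erase_of_mem (mem_univ _), card_univ, smul_eq_mul]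

lemma card_sgn_mul_walsh_eq_zero (hT : T ≠ 0)
    (hN : (N : ℤ) * T ^ 2 = (Fintype.card F : ℤ) ^ 2)
    (hw : ∀ a : F, a ≠ 0 → ∀ b, walsh e a b ^ 2 = 0 ∨ walsh e a b ^ 2 = T ^ 2) :
    (univ.filter fun p : F × F × ZMod 2 => sgn p.2.2 * walsh e p.1 p.2.1 = 0).card =
      2 * (Fintype.card F - 1) * (Fintype.card F - N + 1) := by
  have hsum : ∀ a : F, ∑ b : F,
      ((if walsh e a b = 0 then 1 else 0) + (if -walsh e a b = 0 then 1 else 0)) =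
        2 * (univ.filter fun b => ¬ walsh e a b ≠ 0).card := by
    intro a
    simp_rw [neg_eq_zero, ← two_mul, ← mul_sum, not_not, card_filter]
  have hsub : ∀ a : F, (univ.filter fun b => ¬ walsh e a b ≠ 0).card =
      Fintype.card F - (univ.filter fun b => walsh e a b ≠ 0).card := by
    intro a
    have := card_filter_add_card_filter_not (s := univ) (fun b => walsh e a b ≠ 0)
    rw [card_univ] at this
    omega
  have hone : (univ.filter fun b : F => b = 0).card = 1 := card_eq_one.2 ⟨0, by ext; simp⟩
  have hzero : (univ.filter fun b : F => walsh e 0 b ≠ 0).card = 1 := by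
    rw [← hone]
    simp [walsh_zero_left]
  have key : ∀ a : F, ∑ b : F,
      ((if walsh e a b = 0 then 1 else 0) + (if -walsh e a b = 0 then 1 else 0)) =
        if a ≠ 0 then 2 * (Fintype.card F - N) else 2 * (Fintype.card F - 1) := by
    intro a
    rw [hsum, hsub]
    split_ifs with ha
    · rw [card_walsh_ne_zero hT hN (hw a ha)]
    · rw [not_not.1 ha, hzero]
  rw [card_sgn_mul_walsh_eq, sum_congr rfl fun a _ => key a, sum_ite, sum_const, sum_const,
    filter_ne' univ (0 : F), card_erase_of_mem (mem_univ _), card_univ]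
  simp only [not_not, hone, smul_eq_mul]
  ring

end Counting

section Dual

variable {m e : ℕ}

lemma mem_extCode_iff (c : GaloisField 2 m → ZMod 2) :
    c ∈ extCode m e ↔ (∑ g, c g = 0) ∧
      (∑ g, algebraMap (ZMod 2) (GaloisField 2 m) (c g) * g = 0) ∧
      ∑ g, algebraMap (ZMod 2) (GaloisField 2 m) (c g) * g ^ (2 ^ e + 1) = 0 := by
  simp [extCode, parF, phiF, and_assoc]

lemma sum_mul_codeMap (c : GaloisField 2 m → ZMod 2)
    (p : GaloisField 2 m × GaloisField 2 m × ZMod 2) :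
    ∑ g, c g * codeMap (GaloisField 2 m) e p g =
      absTr (p.1 * ∑ g, algebraMap (ZMod 2) (GaloisField 2 m) (c g) * g ^ (2 ^ e + 1)) +
        absTr (p.2.1 * ∑ g, algebraMap (ZMod 2) (GaloisField 2 m) (c g) * g) +
        (∑ g, c g) * p.2.2 := by
  simp only [absTr, mul_sum, map_sum, sum_mul, ← sum_add_distrib]
  refine sum_congr rfl fun g _ => ?_
  rw [codeMap_apply, quadFun, mul_add, absTr, ← smul_eq_mul (c g), ← map_smul,
    Algebra.smul_def, mul_add, mul_left_comm _ p.1, mul_left_comm _ p.2.1, map_add]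

lemma eq_zero_of_absTr_mul_eq_zero {F : Type*} [Field F] [Fintype F] [Algebra (ZMod 2) F] {s : F}
    (h : ∀ a : F, absTr (a * s) = 0) : s = 0 := by
  by_contra hs
  obtain ⟨b, hb⟩ := exists_absTr_mul_ne_zero hs
  exact hb (mul_comm s b ▸ h b)

lemma mem_extCode_of_forall_codeMap {c : GaloisField 2 m → ZMod 2}
    (hc : ∀ p, ∑ g, c g * codeMap (GaloisField 2 m) e p g = 0) : c ∈ extCode m e := by
  simp_rw [sum_mul_codeMap] at hc
  refine (mem_extCode_iff c).2 ⟨?_, ?_, ?_⟩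
  · simpa using hc (0, 0, 1)
  · exact eq_zero_of_absTr_mul_eq_zero fun b => by simpa using hc (0, b, 0)
  · exact eq_zero_of_absTr_mul_eq_zero fun a => by simpa using hc (a, 0, 0)

/-- Delsarte's description of the dual code by trace functions. -/
lemma dualCode_eq_range : dualCode m e = LinearMap.range (codeMap (GaloisField 2 m) e) := by
  apply le_antisymm
  · intro y hy
    by_contra hmem
    obtain ⟨f, hfy, hf⟩ := Submodule.exists_le_ker_of_notMem hmem
    have hrep : ∀ z : GaloisField 2 m → ZMod 2, f z = ∑ g, f (Pi.single g 1) * z g := by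
      intro z
      conv_lhs => rw [pi_eq_sum_univ' z, map_sum]
      refine sum_congr rfl fun g _ => ?_
      rw [map_smul, smul_eq_mul, mul_comm]
    apply hfy
    rw [hrep]
    refine hy _ (mem_extCode_of_forall_codeMap fun p => ?_)
    rw [← hrep]
    exact hf (LinearMap.mem_range_self _ p)
  · rintro _ ⟨p, rfl⟩ c hc
    obtain ⟨h0, h1, h2⟩ := (mem_extCode_iff c).1 hc
    rw [sum_mul_codeMap, h0, h1, h2]
    simp

/-- The dual code is invariant under the affine group of `F`. -/
lemma comp_affine_mem_dualCode {c : GaloisField 2 m → ZMod 2} (hc : c ∈ dualCode m e)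
    (u v : GaloisField 2 m) : (fun g => c (u * g + v)) ∈ dualCode m e := by
  rw [dualCode_eq_range] at hc ⊢
  obtain ⟨⟨a, b, t⟩, rfl⟩ := hc
  obtain ⟨w, hw⟩ : ∃ w : GaloisField 2 m, w ^ 2 ^ e = a * v * u ^ 2 ^ e :=
    (Finite.injective_iff_surjective.1 (iterateFrobenius (GaloisField 2 m) 2 e).injective)
      (a * v * u ^ 2 ^ e)
  refine ⟨(a * u ^ (2 ^ e + 1), w + a * v ^ 2 ^ e * u + b * u,
    absTr (a * v ^ (2 ^ e + 1) + b * v) + t), ?_⟩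
  funext g
  have h1 : absTr (w * g) = absTr (a * v * u ^ 2 ^ e * g ^ 2 ^ e) := by
    rw [← absTr_pow_two_pow (w * g) e, mul_pow, hw]
  have h2 : a * (u * g + v) ^ (2 ^ e + 1) + b * (u * g + v) =
      a * u ^ (2 ^ e + 1) * g ^ (2 ^ e + 1) + (a * v * u ^ 2 ^ e * g ^ 2 ^ e) +
        (a * v ^ 2 ^ e * u + b * u) * g + (a * v ^ (2 ^ e + 1) + b * v) := by
    rw [pow_succ (u * g + v), add_pow_char_pow]
    ring
  have h3 : a * u ^ (2 ^ e + 1) * g ^ (2 ^ e + 1) + (w + a * v ^ 2 ^ e * u + b * u) * g =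
      a * u ^ (2 ^ e + 1) * g ^ (2 ^ e + 1) + w * g + (a * v ^ 2 ^ e * u + b * u) * g := by ring
  simp only [codeMap_apply, quadFun, absTr] at h1 ⊢
  rw [h2, h3]
  simp only [map_add, h1]
  ring

end Dual

section Design

/-- The number of pairs of a point pair and a block containing it, counted in two ways. -/
lemma card_offDiag_mul_eq {α : Type*} [Fintype α] {S : Finset (α → ZMod 2)} {k l : ℕ}
    (hk : ∀ c ∈ S, (univ.filter fun g => c g ≠ 0).card = k)
    (hl : ∀ x y : α, x ≠ y → (S.filter fun c => c x ≠ 0 ∧ c y ≠ 0).card = l) :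
    Fintype.card α * (Fintype.card α - 1) * l = S.card * (k * (k - 1)) := by
  have h := sum_card_bipartiteAbove_eq_sum_card_bipartiteBelow
    (s := (univ : Finset α).offDiag) (t := S)
    (fun (p : α × α) (c : α → ZMod 2) => c p.1 ≠ 0 ∧ c p.2 ≠ 0)
  have h1 : ∀ p ∈ (univ : Finset α).offDiag,
      (S.bipartiteAbove (fun (p : α × α) c => c p.1 ≠ 0 ∧ c p.2 ≠ 0) p).card = l :=
    fun p hp => hl _ _ (mem_offDiag.1 hp).2.2
  have h2 : ∀ c ∈ S, ((univ : Finset α).offDiag.bipartiteBelow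
      (fun (p : α × α) c => c p.1 ≠ 0 ∧ c p.2 ≠ 0) c).card = k * (k - 1) := by
    intro c hc
    have : (univ : Finset α).offDiag.bipartiteBelow
        (fun (p : α × α) c => c p.1 ≠ 0 ∧ c p.2 ≠ 0) c =
          (univ.filter fun g => c g ≠ 0).offDiag := by
      ext p
      simp only [mem_bipartiteBelow, mem_offDiag, mem_filter, mem_univ, true_and]
      tauto
    rw [this, offDiag_card, hk c hc, Nat.mul_sub_one]
  rwa [sum_congr rfl h1, sum_congr rfl h2, sum_const, sum_const, offDiag_card, card_univ,
    smul_eq_mul, smul_eq_mul, ← Nat.mul_sub_one] at h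

variable {m e : ℕ}

lemma wt_comp_affine (c : GaloisField 2 m → ZMod 2) {u : GaloisField 2 m} (hu : u ≠ 0)
    (v : GaloisField 2 m) : wt (fun g => c (u * g + v)) = wt c := by
  refine card_bijective (fun g => u * g + v) ?_ fun g => by simp
  exact ((Equiv.mulLeft₀ u hu).trans (Equiv.addRight v)).bijective

lemma card_filter_pair_le {k : ℕ} {x y x' y' : GaloisField 2 m} (hxy : x ≠ y) (hxy' : x' ≠ y') :
    ((univ.filter fun c => c ∈ dualCode m e ∧ wt c = k).filter
        fun c => c x ≠ 0 ∧ c y ≠ 0).card ≤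
      ((univ.filter fun c => c ∈ dualCode m e ∧ wt c = k).filter
        fun c => c x' ≠ 0 ∧ c y' ≠ 0).card := by
  have hd : y' - x' ≠ 0 := sub_ne_zero.2 hxy'.symm
  set u := (y - x) / (y' - x') with hu_def
  set v := x - u * x' with hv_def
  have hu : u ≠ 0 := div_ne_zero (sub_ne_zero.2 hxy.symm) hd
  have hx : u * x' + v = x := by rw [hv_def]; ring
  have hy : u * y' + v = y := by
    rw [hv_def]
    linear_combination div_mul_cancel₀ (y - x) hd
  refine card_le_card_of_injOn (fun c g => c (u * g + v)) ?_ ?_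
  · intro c hc
    simp only [coe_filter, mem_filter, mem_univ, true_and, Set.mem_ofPred_eq] at hc ⊢
    exact ⟨⟨comp_affine_mem_dualCode hc.1.1 u v, (wt_comp_affine c hu v).trans hc.1.2⟩,
      by rw [hx]; exact hc.2.1, by rw [hy]; exact hc.2.2⟩
  · intro c _ c' _ hcc
    funext g
    have := congrFun hcc (u⁻¹ * (g - v))
    simpa [mul_inv_cancel_left₀ hu] using this

lemma card_pair_mul_eq (k : ℕ) {x y : GaloisField 2 m} (hxy : x ≠ y) :
    Fintype.card (GaloisField 2 m) * (Fintype.card (GaloisField 2 m) - 1) *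
        Nat.card {c : GaloisField 2 m → ZMod 2 // c ∈ dualCode m e ∧ wt c = k ∧
          c x ≠ 0 ∧ c y ≠ 0} =
      (univ.filter fun c : GaloisField 2 m → ZMod 2 => c ∈ dualCode m e ∧ wt c = k).card *
        (k * (k - 1)) := by
  refine card_offDiag_mul_eq (fun c hc => (mem_filter.1 hc).2.2) fun x' y' hxy' => ?_
  rw [Nat.card_eq_fintype_card, Fintype.card_subtype]
  simpa only [filter_filter, and_assoc] using
    le_antisymm (card_filter_pair_le (e := e) (k := k) hxy' hxy) (card_filter_pair_le hxy hxy')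

lemma card_dualCode_wt_eq {k : ℕ} {t : ℤ}
    (hinj : Function.Injective (codeMap (GaloisField 2 m) e))
    (ht : t = Fintype.card (GaloisField 2 m) - 2 * (k : ℤ)) :
    (univ.filter fun c : GaloisField 2 m → ZMod 2 => c ∈ dualCode m e ∧ wt c = k).card =
      (univ.filter fun p : GaloisField 2 m × GaloisField 2 m × ZMod 2 =>
        sgn p.2.2 * walsh e p.1 p.2.1 = t).card := by
  have hwt : ∀ p, sgn p.2.2 * walsh e p.1 p.2.1 = t ↔
      wt (codeMap (GaloisField 2 m) e p) = k := by
    intro p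
    rw [sgn_mul_walsh, ht, wt]
    omega
  rw [← card_map ⟨_, hinj⟩]
  congr 1
  ext c
  simp only [dualCode_eq_range, LinearMap.mem_range, mem_filter, mem_univ, true_and, mem_map,
    Function.Embedding.coeFn_mk, hwt]
  constructor
  · rintro ⟨⟨p, rfl⟩, hp⟩
    exact ⟨p, hp, rfl⟩
  · rintro ⟨p, hp, rfl⟩
    exact ⟨⟨p, rfl⟩, hp⟩

end Design

/-- When `m/gcd(m,e)` is odd and `h = (m-gcd(m,e))/2`, the supports of the weight-`k`
codewords of `C̄_e^⊥` form 2-designs: every 2-element subset `{x,y}` of `F` is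
contained in the supports of exactly `λ` codewords of weight `k`, for the listed
pairs `(k,λ)`.  (Distinct binary codewords have distinct supports.) -/
theorem dualCode_designs_odd_case (m e : ℕ) (hm : 4 ≤ m)
    (he1 : 1 ≤ e) (he2 : 2 * e ≤ m) (hodd : Odd (m / Nat.gcd m e))
    (h : ℕ) (hh : h = (m - Nat.gcd m e) / 2)
    (x y : GaloisField 2 m) (hxy : x ≠ y) :
    Nat.card {c : GaloisField 2 m → ZMod 2 // c ∈ dualCode m e ∧
        wt c = 2 ^ (m - 1) - 2 ^ (m - 1 - h) ∧ c x ≠ 0 ∧ c y ≠ 0} =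
      (2 ^ (2 * h - 1) - 2 ^ (h - 1)) * (2 ^ (m - 1) - 2 ^ (m - 1 - h) - 1) ∧
    Nat.card {c : GaloisField 2 m → ZMod 2 // c ∈ dualCode m e ∧
        wt c = 2 ^ (m - 1) + 2 ^ (m - 1 - h) ∧ c x ≠ 0 ∧ c y ≠ 0} =
      (2 ^ (2 * h - 1) + 2 ^ (h - 1)) * (2 ^ (m - 1) + 2 ^ (m - 1 - h) - 1) ∧
    Nat.card {c : GaloisField 2 m → ZMod 2 // c ∈ dualCode m e ∧
        wt c = 2 ^ (m - 1) ∧ c x ≠ 0 ∧ c y ≠ 0} =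
      (2 ^ (m - 1) - 1) * (2 ^ m - 2 ^ (2 * h) + 1) := by
  have hd1 : 1 ≤ m.gcd e := Nat.gcd_pos_of_pos_left e (by omega)
  obtain ⟨hh1, hmd⟩ := exists_eq_gcd_add_two_mul he1 he2 hodd
  rw [← hh] at hh1 hmd
  have hgcd := gcd_two_mul_eq (by omega) hodd
  have hF : Fintype.card (GaloisField 2 m) = 2 ^ m := by
    rw [← Nat.card_eq_fintype_card, GaloisField.card 2 m (by omega)]
  generalize hd : m.gcd e = d at hd1 hmd
  obtain ⟨s, rfl⟩ : ∃ s, h = s + 1 := ⟨h - 1, by omega⟩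
  set H := 2 ^ s with hH
  set D := 2 ^ d with hD
  have hH1 : 1 ≤ H := Nat.one_le_two_pow
  have hD1 : 2 ≤ D := by simpa using Nat.pow_le_pow_right two_pos hd1
  have e1 : 2 ^ m = 4 * D * H ^ 2 := by
    rw [hH, hD, hmd]
    ring
  have e2 : 2 ^ (m - 1) = 2 * D * H ^ 2 := by
    rw [hH, hD, show m - 1 = d + 2 * s + 1 by omega]
    ring
  have e3 : 2 ^ (m - 1 - (s + 1)) = D * H := by
    rw [hH, hD, show m - 1 - (s + 1) = d + s by omega]
    ring
  have e4 : 2 ^ (2 * (s + 1) - 1) = 2 * H ^ 2 := by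
    rw [hH, show 2 * (s + 1) - 1 = 2 * s + 1 by omega]
    ring
  have e5 : 2 ^ (2 * (s + 1)) = 4 * H ^ 2 := by
    rw [hH]
    ring
  rw [e1] at hF
  have hT : (2 * D * H : ℤ) ≠ 0 := by positivity
  have hN : ((4 * H ^ 2 : ℕ) : ℤ) * (2 * D * H) ^ 2 =
      (Fintype.card (GaloisField 2 m) : ℤ) ^ 2 := by
    rw [hF]
    push_cast
    ring
  have hw : ∀ a : GaloisField 2 m, a ≠ 0 → ∀ b,
      walsh e a b ^ 2 = 0 ∨ walsh e a b ^ 2 = (2 * D * H : ℤ) ^ 2 := by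
    intro a ha b
    have hr := card_radMap_eq_zero (hF.trans e1.symm) he1 hgcd ha
    have := walsh_sq_eq_or e a b
    rw [hr, hF, hd, ← hD] at this
    refine this.imp_right fun h => ?_
    rw [h]
    push_cast
    ring
  have hTF : (2 * D * H : ℤ) ^ 2 ≠ (Fintype.card (GaloisField 2 m) : ℤ) ^ 2 := by
    rw [← hN]
    intro h
    have h1 : (1 : ℤ) = ((4 * H ^ 2 : ℕ) : ℤ) :=
      mul_right_cancel₀ (pow_ne_zero 2 hT) (by linear_combination h)
    have h2 : 1 = 4 * H ^ 2 := by exact_mod_cast h1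
    omega
  have hinj : Function.Injective (codeMap (GaloisField 2 m) e) := by
    refine codeMap_injective fun a ha b hab => ?_
    rcases hw a ha b with h | h
    · rw [h, hF] at hab
      have : (0 : ℤ) < ((4 * D * H ^ 2 : ℕ) : ℤ) ^ 2 := by positivity
      omega
    · exact hTF (h ▸ hab)
  have hq : 0 < 4 * D * H ^ 2 * (4 * D * H ^ 2 - 1) := by
    have h1 : 0 < D * H ^ 2 := by positivity
    have h2 : 4 * D * H ^ 2 = 4 * (D * H ^ 2) := by ring
    exact Nat.mul_pos (by omega) (by omega)
  have hDH : D * H ≤ 2 * D * H ^ 2 := by nlinarith [Nat.mul_le_mul_left (D * H) hH1]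
  have hHH : H ≤ 2 * H ^ 2 := by nlinarith
  rw [e2, e3, e4, e5, e1, show s + 1 - 1 = s by omega, ← hH]
  refine ⟨?_, ?_, ?_⟩ <;> apply Nat.eq_of_mul_eq_mul_left hq
  · have key := card_pair_mul_eq (e := e) (2 * D * H ^ 2 - D * H) hxy
    rw [card_dualCode_wt_eq (t := 2 * D * H) hinj (by rw [hF]; push_cast [hDH]; ring),
      card_sgn_mul_walsh_eq_of_ne_zero hT hN hTF hw, hF] at key
    rw [key]
    have h1 : D * (2 * H ^ 2 - H) = 2 * D * H ^ 2 - D * H := by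
      rw [Nat.mul_sub]
      congr 1
      ring
    generalize 4 * D * H ^ 2 - 1 = q
    rw [← h1]
    ring
  · have key := card_pair_mul_eq (e := e) (2 * D * H ^ 2 + D * H) hxy
    rw [card_dualCode_wt_eq (t := -(2 * D * H)) hinj (by rw [hF]; push_cast; ring),
      card_sgn_mul_walsh_eq_of_ne_zero (neg_ne_zero.2 hT) (by rw [neg_sq, hN])
        (by rwa [neg_sq]) (by simpa only [neg_sq] using hw), hF] at key
    rw [key]
    generalize 4 * D * H ^ 2 - 1 = q
    generalize 2 * D * H ^ 2 + D * H - 1 = r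
    ring
  · have key := card_pair_mul_eq (e := e) (2 * D * H ^ 2) hxy
    rw [card_dualCode_wt_eq (t := 0) hinj (by rw [hF]; push_cast; ring),
      card_sgn_mul_walsh_eq_zero hT hN hw, hF] at key
    rw [key]
    ring
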